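/- Let θ ∈ [π, 2π) be fixed. Then for all x, y ∈ S_θ, the inequality p_{S_θ}(x,y) ≤ s_{S_θ}(x,y) holds. -/

import Mathlib

open Set Metric Complex

/-- The open sector of angle `θ`: points with polar angle strictly between `0` and `θ`. -/
noncomputable def sector (θ : ℝ) : Set ℂ :=
  {z : ℂ | ∃ r φ : ℝ, 0 < r ∧ 0 < φ ∧ φ < θ ∧ z = r * Complex.exp (φ * Complex.I)}

/-- Distance from `x` to the boundary of `G`. -/
noncomputable def distBd (G : Set ℂ) (x : ℂ) : ℝ :=
  Metric.infDist x (frontier G)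

/-- The triangular ratio metric `s_G`. -/
noncomputable def triRatio (G : Set ℂ) (x y : ℂ) : ℝ :=
  dist x y / sInf ((fun z => dist x z + dist z y) '' frontier G)

/-- The `j*`-metric. -/
noncomputable def jStar (G : Set ℂ) (x y : ℂ) : ℝ :=
  dist x y / (dist x y + 2 * min (distBd G x) (distBd G y))

/-- The point pair function `p_G`. -/
noncomputable def pointPair (G : Set ℂ) (x y : ℂ) : ℝ :=
  dist x y / Real.sqrt (dist x y ^ 2 + 4 * distBd G x * distBd G y)

lemma ofReal_mul_exp_re (r φ : ℝ) :
    ((r : ℂ) * Complex.exp (φ * Complex.I)).re = r * Real.cos φ := by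
  rw [Complex.re_ofReal_mul, Complex.exp_ofReal_mul_I_re]

lemma ofReal_mul_exp_im (r φ : ℝ) :
    ((r : ℂ) * Complex.exp (φ * Complex.I)).im = r * Real.sin φ := by
  rw [Complex.im_ofReal_mul, Complex.exp_ofReal_mul_I_im]

lemma ofReal_mul_exp_mul_exp (r φ ψ : ℝ) :
    (r : ℂ) * Complex.exp (φ * Complex.I) * Complex.exp (ψ * Complex.I)
      = r * Complex.exp ((φ + ψ : ℝ) * Complex.I) := by
  rw [mul_assoc, ← Complex.exp_add]
  push_cast
  ring_nf

lemma norm_ofReal_mul_exp {r : ℝ} (hr : 0 ≤ r) (φ : ℝ) :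
    ‖(r : ℂ) * Complex.exp (φ * Complex.I)‖ = r := by
  rw [norm_mul, Complex.norm_exp_ofReal_mul_I, mul_one, Complex.norm_real, Real.norm_of_nonneg hr]

lemma arg_ofReal_mul_exp {r φ : ℝ} (hr : 0 < r) (hφ : φ ∈ Ioc (-Real.pi) Real.pi) :
    ((r : ℂ) * Complex.exp (φ * Complex.I)).arg = φ := by
  rw [Complex.exp_mul_I, Complex.arg_mul_cos_add_sin_mul_I hr hφ]

/-- Rotating by `-θ / 2` turns the sector into the set of nonzero points whose principal argument
has absolute value less than `θ / 2`. -/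
lemma mem_sector_iff {θ : ℝ} (hθ : θ < 2 * Real.pi) (z : ℂ) :
    z ∈ sector θ ↔ z ≠ 0 ∧ |(z * Complex.exp ((-(θ / 2) : ℝ) * Complex.I)).arg| < θ / 2 := by
  constructor
  · rintro ⟨r, φ, hr, h0, h1, rfl⟩
    refine ⟨mul_ne_zero (by exact_mod_cast hr.ne') (Complex.exp_ne_zero _), ?_⟩
    rw [ofReal_mul_exp_mul_exp, arg_ofReal_mul_exp hr]
    · rw [abs_lt]; constructor <;> linarith
    · constructor <;> linarith
  · rintro ⟨hz, h⟩
    rw [abs_lt] at h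
    set w := z * Complex.exp ((-(θ / 2) : ℝ) * Complex.I) with hw
    refine ⟨‖w‖, w.arg + θ / 2, ?_, by linarith, by linarith, ?_⟩
    · exact norm_pos_iff.2 (mul_ne_zero hz (Complex.exp_ne_zero _))
    · rw [← ofReal_mul_exp_mul_exp, Complex.norm_mul_exp_arg_mul_I, hw, mul_assoc,
        ← Complex.exp_add]
      simp

lemma isOpen_sector {θ : ℝ} (hθ : θ < 2 * Real.pi) : IsOpen (sector θ) := by
  have hs : IsOpen (Complex.slitPlane ∩ Complex.arg ⁻¹' Ioo (-(θ / 2)) (θ / 2)) :=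
    ContinuousOn.isOpen_inter_preimage
      (fun z hz => (Complex.continuousAt_arg hz).continuousWithinAt)
      Complex.isOpen_slitPlane isOpen_Ioo
  have hf : Continuous fun z : ℂ => z * Complex.exp ((-(θ / 2) : ℝ) * Complex.I) := by fun_prop
  convert hs.preimage hf using 1
  ext z
  rw [mem_sector_iff hθ]
  simp only [mem_preimage, mem_inter_iff, mem_Ioo, Complex.mem_slitPlane_iff_arg, ne_eq,
    mul_eq_zero, Complex.exp_ne_zero, or_false, abs_lt]
  constructor
  · rintro ⟨h0, h⟩
    exact ⟨⟨fun h' => by rw [h'] at h; linarith [h.2], h0⟩, h⟩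
  · rintro ⟨⟨-, h0⟩, h⟩
    exact ⟨h0, h⟩

lemma ofReal_mul_exp_mem_closure_sector {θ t φ : ℝ} (hθ : 0 < θ) (ht : 0 ≤ t)
    (h0 : 0 ≤ φ) (h1 : φ ≤ θ) :
    (t : ℂ) * Complex.exp (φ * Complex.I) ∈ closure (sector θ) := by
  have hf : Continuous fun p : ℝ × ℝ => (p.1 : ℂ) * Complex.exp (p.2 * Complex.I) := by fun_prop
  have hm : MapsTo (fun p : ℝ × ℝ => (p.1 : ℂ) * Complex.exp (p.2 * Complex.I))
      (Ioi 0 ×ˢ Ioo 0 θ) (sector θ) := by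
    rintro ⟨r, ψ⟩ ⟨hr, hψ⟩
    exact ⟨r, ψ, hr, hψ.1, hψ.2, rfl⟩
  refine hm.closure hf (x := (t, φ)) ?_
  rw [closure_prod_eq, closure_Ioi, closure_Ioo hθ.ne]
  exact ⟨ht, h0, h1⟩

lemma ofReal_mem_frontier_sector {θ t : ℝ} (h0 : 0 < θ) (hθ : θ < 2 * Real.pi) (ht : 0 ≤ t) :
    (t : ℂ) ∈ frontier (sector θ) := by
  rw [(isOpen_sector hθ).frontier_eq]
  refine ⟨by simpa using ofReal_mul_exp_mem_closure_sector h0 ht le_rfl h0.le, ?_⟩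
  rw [mem_sector_iff hθ]
  rintro ⟨hz, h⟩
  have ht' : 0 < t := ht.lt_of_ne fun h => hz (by simp [← h])
  rw [arg_ofReal_mul_exp ht' (by constructor <;> linarith [Real.pi_pos]),
    abs_neg, abs_of_pos (by linarith)] at h
  exact h.false

lemma ofReal_mul_exp_mem_frontier_sector {θ t : ℝ} (h0 : 0 < θ) (hθ : θ < 2 * Real.pi)
    (ht : 0 ≤ t) : (t : ℂ) * Complex.exp (θ * Complex.I) ∈ frontier (sector θ) := by
  rw [(isOpen_sector hθ).frontier_eq]
  refine ⟨ofReal_mul_exp_mem_closure_sector h0 ht h0.le le_rfl, ?_⟩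
  rw [mem_sector_iff hθ]
  rintro ⟨hz, h⟩
  have ht' : 0 < t := ht.lt_of_ne fun h => hz (by simp [← h])
  rw [ofReal_mul_exp_mul_exp,
    arg_ofReal_mul_exp ht' (by constructor <;> linarith [Real.pi_pos]),
    abs_of_pos (by linarith)] at h
  linarith

/-- If `m` is a direction in the polar cone of the complement of the sector, the complement lies
in the half-plane where the component along `m` is nonpositive. -/
lemma re_mul_exp_nonpos_of_notMem_sector {θ m : ℝ} (hθ : θ < 2 * Real.pi)
    (h0 : Real.pi / 2 ≤ m) (h1 : m ≤ θ - Real.pi / 2) {z : ℂ} (hz : z ∉ sector θ) :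
    (z * Complex.exp ((-m : ℝ) * Complex.I)).re ≤ 0 := by
  rw [mem_sector_iff hθ] at hz
  rcases eq_or_ne z 0 with rfl | hz0
  · simp
  have harg := not_lt.1 fun h => hz ⟨hz0, h⟩
  set w := z * Complex.exp ((-(θ / 2) : ℝ) * Complex.I) with hw
  have hzw : z * Complex.exp ((-m : ℝ) * Complex.I)
      = ‖w‖ * Complex.exp ((w.arg + (θ / 2 - m) : ℝ) * Complex.I) := by
    rw [← ofReal_mul_exp_mul_exp, Complex.norm_mul_exp_arg_mul_I, hw, mul_assoc,
      ← Complex.exp_add]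
    push_cast
    ring_nf
  rw [hzw, ofReal_mul_exp_re]
  refine mul_nonpos_of_nonneg_of_nonpos (norm_nonneg _) ?_
  have hl := Complex.neg_pi_lt_arg w
  have hu := Complex.arg_le_pi w
  rcases le_abs.1 harg with h | h
  · exact Real.cos_nonpos_of_pi_div_two_le_of_le (by linarith) (by linarith)
  · rw [← Real.cos_neg]
    exact Real.cos_nonpos_of_pi_div_two_le_of_le (by linarith) (by linarith)

lemma mul_cos_sub_le_distBd_sector {θ m : ℝ} (hθ : θ < 2 * Real.pi)
    (h0 : Real.pi / 2 ≤ m) (h1 : m ≤ θ - Real.pi / 2) (r φ : ℝ) :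
    r * Real.cos (φ - m) ≤ distBd (sector θ) (r * Complex.exp (φ * Complex.I)) := by
  have hne : (frontier (sector θ)).Nonempty :=
    ⟨_, ofReal_mem_frontier_sector (by linarith [Real.pi_pos]) hθ le_rfl⟩
  refine (le_infDist hne).2 fun z hz => ?_
  rw [(isOpen_sector hθ).frontier_eq] at hz
  have hz' := re_mul_exp_nonpos_of_notMem_sector hθ h0 h1 hz.2
  have hle := Complex.re_le_norm
    ((r * Complex.exp (φ * Complex.I) - z) * Complex.exp ((-m : ℝ) * Complex.I))
  rw [norm_mul, Complex.norm_exp_ofReal_mul_I, mul_one, sub_mul, Complex.sub_re,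
    ofReal_mul_exp_mul_exp, ofReal_mul_exp_re, ← sub_eq_add_neg] at hle
  rw [dist_eq_norm]
  linarith

/-- A segment from the open upper to the closed lower half-plane that meets the real axis in a
nonnegative point. -/
lemma exists_ofReal_dist_add_dist_eq {x w : ℂ} (hx : 0 < x.im) (hw : w.im ≤ 0)
    (h : 0 ≤ w.re * x.im - x.re * w.im) :
    ∃ t : ℝ, 0 ≤ t ∧ dist x t + dist (t : ℂ) w = dist x w := by
  have hpos : 0 < x.im - w.im := by linarith
  refine ⟨(w.re * x.im - x.re * w.im) / (x.im - w.im), div_nonneg h hpos.le, ?_⟩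
  refine dist_add_dist_of_mem_segment ?_
  refine ⟨-w.im / (x.im - w.im), x.im / (x.im - w.im), div_nonneg (by linarith) hpos.le,
    div_nonneg hx.le hpos.le, by field_simp; ring, ?_⟩
  apply Complex.ext
  · simp only [Complex.add_re, Complex.real_smul, Complex.re_ofReal_mul, Complex.ofReal_re]
    field_simp
    ring
  · simp only [Complex.add_im, Complex.real_smul, Complex.im_ofReal_mul, Complex.ofReal_im]
    field_simp
    ring

/-- Reflection principle in the positive real axis. -/
lemma exists_ofReal_dist_add_dist_sq_eq {r s φ ψ : ℝ} (hr : 0 < r) (hs : 0 < s) (hφ : 0 < φ)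
    (hψ : 0 < ψ) (h : φ + ψ ≤ Real.pi) :
    ∃ t : ℝ, 0 ≤ t ∧
      (dist ((r : ℂ) * Complex.exp (φ * Complex.I)) t
        + dist (t : ℂ) (s * Complex.exp (ψ * Complex.I))) ^ 2
      = dist ((r : ℂ) * Complex.exp (φ * Complex.I)) (s * Complex.exp (ψ * Complex.I)) ^ 2
        + 4 * (r * Real.sin φ) * (s * Real.sin ψ) := by
  have hsφ : 0 < r * Real.sin φ := mul_pos hr (Real.sin_pos_of_pos_of_lt_pi hφ (by linarith))
  have hsψ : 0 < s * Real.sin ψ := mul_pos hs (Real.sin_pos_of_pos_of_lt_pi hψ (by linarith))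
  have hsum := mul_nonneg (mul_pos hr hs).le
    (Real.sin_nonneg_of_nonneg_of_le_pi (add_pos hφ hψ).le h)
  rw [Real.sin_add] at hsum
  rw [← ofReal_mul_exp_im] at hsφ hsψ
  obtain ⟨t, ht, hd⟩ := exists_ofReal_dist_add_dist_eq (x := r * Complex.exp (φ * Complex.I))
    (w := (starRingEnd ℂ) (s * Complex.exp (ψ * Complex.I))) hsφ
    (by rw [Complex.conj_im]; linarith)
    (by
      rw [Complex.conj_im, Complex.conj_re]
      simp only [ofReal_mul_exp_im, ofReal_mul_exp_re]
      linarith)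
  refine ⟨t, ht, ?_⟩
  have hconj : dist (t : ℂ) ((starRingEnd ℂ) (s * Complex.exp (ψ * Complex.I)))
      = dist (t : ℂ) (s * Complex.exp (ψ * Complex.I)) := by
    rw [← Complex.dist_conj_conj, Complex.conj_conj, Complex.conj_ofReal]
  rw [← hconj, hd, Complex.dist_eq_re_im, Complex.dist_eq_re_im, Real.sq_sqrt (by positivity),
    Real.sq_sqrt (by positivity), Complex.conj_im, Complex.conj_re]
  simp only [ofReal_mul_exp_im, ofReal_mul_exp_re]
  ring

lemma dist_reflect (θ r s φ ψ : ℝ) :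
    dist ((r : ℂ) * Complex.exp ((θ - φ : ℝ) * Complex.I))
        (s * Complex.exp ((θ - ψ : ℝ) * Complex.I))
      = dist ((r : ℂ) * Complex.exp (φ * Complex.I)) (s * Complex.exp (ψ * Complex.I)) := by
  rw [← Complex.dist_conj_conj ((r : ℂ) * Complex.exp (φ * Complex.I)), dist_eq_norm,
    dist_eq_norm, ← mul_one ‖(starRingEnd ℂ) _ - _‖, ← Complex.norm_exp_ofReal_mul_I θ,
    ← norm_mul, sub_mul]
  simp only [map_mul, Complex.conj_ofReal, ← Complex.exp_conj, Complex.conj_I, mul_assoc,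
    ← Complex.exp_add]
  push_cast
  ring_nf

lemma dist_ofReal_mul_exp_sq (r s φ ψ : ℝ) :
    dist ((r : ℂ) * Complex.exp (φ * Complex.I)) (s * Complex.exp (ψ * Complex.I)) ^ 2
      = r ^ 2 + s ^ 2 - 2 * r * s * Real.cos (ψ - φ) := by
  rw [Complex.dist_eq_re_im, Real.sq_sqrt (by positivity), Real.cos_sub]
  simp only [ofReal_mul_exp_im, ofReal_mul_exp_re]
  linear_combination r ^ 2 * Real.sin_sq_add_cos_sq φ + s ^ 2 * Real.sin_sq_add_cos_sq ψ

/-- Some broken line through the boundary is no longer than the denominator of the point pair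
function. -/
lemma exists_frontier_dist_add_dist_sq_le {θ r s φ ψ : ℝ} (hθ₀ : Real.pi ≤ θ)
    (hθ : θ < 2 * Real.pi) (hr : 0 < r) (hs : 0 < s) (hφ : 0 < φ) (hφψ : φ ≤ ψ) (hψ : ψ < θ) :
    ∃ z ∈ frontier (sector θ),
      (dist ((r : ℂ) * Complex.exp (φ * Complex.I)) z
        + dist z (s * Complex.exp (ψ * Complex.I))) ^ 2
      ≤ dist ((r : ℂ) * Complex.exp (φ * Complex.I)) (s * Complex.exp (ψ * Complex.I)) ^ 2
        + 4 * (distBd (sector θ) (r * Complex.exp (φ * Complex.I))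
          * distBd (sector θ) (s * Complex.exp (ψ * Complex.I))) := by
  have hpi := Real.pi_pos
  have hθpos : 0 < θ := by linarith
  have hbound (m : ℝ) (h0 : Real.pi / 2 ≤ m) (h1 : m ≤ θ - Real.pi / 2)
      (hc : 0 ≤ Real.cos (ψ - m)) :
      r * Real.cos (φ - m) * (s * Real.cos (ψ - m))
        ≤ distBd (sector θ) (r * Complex.exp (φ * Complex.I))
          * distBd (sector θ) (s * Complex.exp (ψ * Complex.I)) :=
    mul_le_mul (mul_cos_sub_le_distBd_sector hθ h0 h1 r φ)
      (mul_cos_sub_le_distBd_sector hθ h0 h1 s ψ) (mul_nonneg hs.le hc) infDist_nonneg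
  rcases le_or_gt Real.pi (ψ - φ) with hfar | hnear
  · have hsφ : 0 < r * Real.sin φ := mul_pos hr (Real.sin_pos_of_pos_of_lt_pi hφ (by linarith))
    have hsψ : s * Real.sin ψ ≤ 0 := by
      refine mul_nonpos_of_nonneg_of_nonpos hs.le ?_
      rw [← Real.sin_sub_two_pi]
      exact Real.sin_nonpos_of_nonpos_of_neg_pi_le (by linarith) (by linarith)
    have hdiff : Real.sin (ψ - φ) ≤ 0 := by
      rw [← Real.sin_sub_two_pi]
      exact Real.sin_nonpos_of_nonpos_of_neg_pi_le (by linarith) (by linarith)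
    rw [Real.sin_sub] at hdiff
    have hdiff' := mul_nonneg (mul_pos hr hs).le (neg_nonneg.2 hdiff)
    rw [← ofReal_mul_exp_im] at hsφ hsψ
    obtain ⟨t, ht, hd⟩ := exists_ofReal_dist_add_dist_eq hsφ hsψ (by
      simp only [ofReal_mul_exp_im, ofReal_mul_exp_re]
      linarith)
    refine ⟨t, ofReal_mem_frontier_sector hθpos hθ ht, ?_⟩
    rw [hd]
    exact le_add_of_nonneg_right
      (mul_nonneg (by norm_num) (mul_nonneg infDist_nonneg infDist_nonneg))
  rcases le_or_gt (φ + ψ) Real.pi with hlow | hlow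
  · obtain ⟨t, ht, hd⟩ := exists_ofReal_dist_add_dist_sq_eq hr hs hφ (hφ.trans_le hφψ) hlow
    refine ⟨t, ofReal_mem_frontier_sector hθpos hθ ht, ?_⟩
    have hb := hbound (Real.pi / 2) le_rfl (by linarith)
      (by rw [Real.cos_sub_pi_div_two]
          exact Real.sin_nonneg_of_nonneg_of_le_pi (by linarith) (by linarith))
    rw [Real.cos_sub_pi_div_two, Real.cos_sub_pi_div_two] at hb
    rw [hd]
    linarith
  rcases le_or_gt (θ - φ + (θ - ψ)) Real.pi with hup | hup
  · obtain ⟨t, ht, hd⟩ := exists_ofReal_dist_add_dist_sq_eq hr hs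
      (show 0 < θ - φ by linarith) (show 0 < θ - ψ by linarith) hup
    have ht0 : (t : ℂ) = t * Complex.exp ((θ - θ : ℝ) * Complex.I) := by simp
    rw [ht0, dist_reflect, dist_reflect, dist_reflect] at hd
    refine ⟨t * Complex.exp (θ * Complex.I), ofReal_mul_exp_mem_frontier_sector hθpos hθ ht, ?_⟩
    have hcos (a : ℝ) : Real.cos (a - (θ - Real.pi / 2)) = Real.sin (θ - a) := by
      rw [← Real.cos_sub_pi_div_two, ← Real.cos_neg]
      ring_nf
    have hb := hbound (θ - Real.pi / 2) (by linarith) le_rfl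
      (by rw [hcos]; exact Real.sin_nonneg_of_nonneg_of_le_pi (by linarith) (by linarith))
    rw [hcos, hcos] at hb
    rw [hd]
    linarith
  · refine ⟨(0 : ℝ), ofReal_mem_frontier_sector hθpos hθ le_rfl, ?_⟩
    have hψm : ψ - (φ + ψ) / 2 = (ψ - φ) / 2 := by ring
    have hφm : Real.cos (φ - (φ + ψ) / 2) = Real.cos ((ψ - φ) / 2) := by
      rw [← Real.cos_neg]
      ring_nf
    have hb := hbound ((φ + ψ) / 2) (by linarith) (by linarith)
      (by rw [hψm]; exact Real.cos_nonneg_of_mem_Icc ⟨by linarith, by linarith⟩)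
    rw [hψm, hφm] at hb
    have hhalf := Real.cos_sq ((ψ - φ) / 2)
    rw [mul_div_cancel₀ _ (two_ne_zero' ℝ)] at hhalf
    rw [dist_ofReal_mul_exp_sq, Complex.ofReal_zero, dist_zero_right, dist_zero_left,
      norm_ofReal_mul_exp hr.le, norm_ofReal_mul_exp hs.le]
    linear_combination 4 * hb - 4 * r * s * hhalf

/-- The comparison of the two metrics at a pair of points follows from a bound on one broken line
through the boundary. -/
lemma pointPair_le_triRatio_of_exists {G : Set ℂ} {x y : ℂ}
    (h : ∃ z ∈ frontier G, (dist x z + dist z y) ^ 2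
      ≤ dist x y ^ 2 + 4 * (distBd G x * distBd G y)) :
    pointPair G x y ≤ triRatio G x y := by
  obtain ⟨z, hz, hle⟩ := h
  unfold pointPair triRatio
  rcases eq_or_ne x y with rfl | hxy
  · simp
  have hlow : dist x y ≤ sInf ((fun z => dist x z + dist z y) '' frontier G) := by
    refine le_csInf ⟨_, mem_image_of_mem _ hz⟩ ?_
    rintro _ ⟨w, -, rfl⟩
    exact dist_triangle x w y
  have hbdd : BddBelow ((fun z => dist x z + dist z y) '' frontier G) := by
    refine ⟨0, ?_⟩
    rintro _ ⟨w, -, rfl⟩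
    positivity
  refine div_le_div_of_nonneg_left dist_nonneg ((dist_pos.2 hxy).trans_le hlow) ?_
  refine (csInf_le hbdd (mem_image_of_mem _ hz)).trans (Real.le_sqrt_of_sq_le ?_)
  rwa [mul_assoc]

theorem stmt_6 (θ : ℝ) (hθ : Real.pi ≤ θ ∧ θ < 2 * Real.pi) :
    ∀ x ∈ sector θ, ∀ y ∈ sector θ,
      pointPair (sector θ) x y ≤ triRatio (sector θ) x y := by
  rintro _ ⟨r, φ, hr, hφ, hφ', rfl⟩ _ ⟨s, ψ, hs, hψ, hψ', rfl⟩
  apply pointPair_le_triRatio_of_exists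
  rcases le_total φ ψ with h | h
  · exact exists_frontier_dist_add_dist_sq_le hθ.1 hθ.2 hr hs hφ h hψ'
  · obtain ⟨z, hz, hle⟩ := exists_frontier_dist_add_dist_sq_le hθ.1 hθ.2 hs hr hψ h hφ'
    refine ⟨z, hz, ?_⟩
    rw [add_comm, dist_comm z, dist_comm ((r : ℂ) * _) z, mul_comm (distBd _ _)]
    rwa [dist_comm (_ * _) (_ * _)] at hle
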